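/- Let $q\geq3$, $m\geq2$, $1\leq t\leq m-1$. If $f\in R_q(t(q-1),m)$ satisfies $|f|=2(q-1)q^{m-t-1}$, then the support of $f$ is contained in an affine subspace of dimension $m-t+1$ of $\mathbb{F}_q^m$. -/

import Mathlib

/-- Membership in the generalized Reed–Muller code `R_q(r,m)`: `f` is represented by a
polynomial of total degree at most `r` (equivalently, its reduced form has degree ≤ r). -/
def RM (F : Type) [Field F] (r m : ℕ) (f : (Fin m → F) → F) : Prop :=
  ∃ P : MvPolynomial (Fin m) F, P.totalDegree ≤ r ∧ ∀ x, MvPolynomial.eval x P = f x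

/-- Hamming weight: the size of the support of `f`. -/
def wt {F : Type} [Field F] [Fintype F] [DecidableEq F] {m : ℕ} (f : (Fin m → F) → F) : ℕ :=
  (Finset.univ.filter fun x => f x ≠ 0).card


section GRM
open Module
set_option linter.unusedSectionVars false
variable {F : Type} [Field F] [Fintype F]

inductive GDeg (F : Type) [Field F] {E : Type} [AddCommGroup E] [Module F E] : ℤ → (E → F) → Prop
  | zero (r : ℤ) : GDeg F r (fun _ => 0)
  | const (r : ℤ) (h : 0 ≤ r) (c : F) : GDeg F r (fun _ => c)
  | add (r : ℤ) (f g : E → F) : GDeg F r f → GDeg F r g → GDeg F r (fun x => f x + g x)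
  | mul (r : ℤ) (f : E → F) (φ : E →ₗ[F] F) : GDeg F r f → GDeg F (r + 1) (fun x => φ x * f x)

variable {E : Type} [AddCommGroup E] [Module F E]

theorem GDeg.mono {r s : ℤ} {f : E → F} (h : GDeg F r f) (hrs : r ≤ s) : GDeg F s f := by
  induction h generalizing s with
  | zero r => exact GDeg.zero s
  | const r h c => exact GDeg.const s (h.trans hrs) c
  | add r f g _ _ ihf ihg => exact GDeg.add s f g (ihf hrs) (ihg hrs)
  | mul r f φ _ ih =>
    have := GDeg.mul (s - 1) f φ (ih (by omega))
    rwa [sub_add_cancel] at this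

theorem GDeg.neg_eq {r : ℤ} {f : E → F} (h : GDeg F r f) (hr : r < 0) : ∀ x, f x = 0 := by
  induction h with
  | zero r => simp
  | const r h c => omega
  | add r f g _ _ ihf ihg => intro x; simp [ihf hr, ihg hr]
  | mul r f φ _ ih => intro x; simp [ih (by omega)]

theorem GDeg.const_eq {r : ℤ} {f : E → F} (h : GDeg F r f) (hr : r ≤ 0) : ∀ x y, f x = f y := by
  induction h with
  | zero r => simp
  | const r h c => simp
  | add r f g _ _ ihf ihg => intro x y; simp only [ihf hr x y, ihg hr x y]
  | mul r f φ h ih => intro x y; simp [h.neg_eq (by omega)]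

theorem GDeg.smul {r : ℤ} {f : E → F} (h : GDeg F r f) (a : F) : GDeg F r (fun x => a * f x) := by
  induction h with
  | zero r => simpa using GDeg.zero r
  | const r h c => exact GDeg.const r h _
  | add r f g _ _ ihf ihg => simpa [mul_add] using GDeg.add r _ _ ihf ihg
  | mul r f φ _ ih => simpa [mul_left_comm] using GDeg.mul r _ φ ih

theorem GDeg.aff {r : ℤ} {f : E → F} (h : GDeg F r f) (φ : E →ₗ[F] F) (a : F) :
    GDeg F (r+1) (fun x => (φ x - a) * f x) := by
  have := GDeg.add _ _ _ (GDeg.mul r f φ h) ((h.smul (-a)).mono (by omega : r ≤ r + 1))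
  simpa [sub_mul, sub_eq_add_neg, add_mul] using this

/-- decomposition along a line -/
theorem GDeg.decomp {r : ℤ} {f : E → F} (h : GDeg F r f) (K : Submodule F E) (v : E) :
    ∃ c : ℕ → K → F, (∀ i : ℕ, GDeg F (r - i) (c i)) ∧ 
      ∀ (y : K) (x : F), f (y + x • v) = ∑ i ∈ Finset.range (Fintype.card F), x ^ i * c i y := by
  have hq : 1 < Fintype.card F := Fintype.one_lt_card
  induction h with
  | zero r => exact ⟨fun _ _ => 0, fun i => GDeg.zero _, by simp⟩
  | const r h a =>
    refine ⟨fun i _ => if i = 0 then a else 0, fun i => ?_, fun y x => ?_⟩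
    · by_cases hi : i = 0
      · subst hi; simpa using GDeg.const r h a
      · simpa [hi] using GDeg.zero _
    · simp [Finset.sum_ite_eq']
  | add r f g _ _ ihf ihg =>
    obtain ⟨c, hc, hc2⟩ := ihf
    obtain ⟨c', hc', hc2'⟩ := ihg
    refine ⟨fun i y => c i y + c' i y, fun i => GDeg.add _ _ _ (hc i) (hc' i), fun y x => ?_⟩
    simp only [hc2, hc2', mul_add, Finset.sum_add_distrib]
  | mul r f φ _ ih =>
    obtain ⟨c, hc, hc2⟩ := ih
    obtain ⟨k, hk⟩ : ∃ k, Fintype.card F = k + 2 := ⟨Fintype.card F - 2, by omega⟩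
    refine ⟨fun i y => (φ.comp K.subtype) y * c i y + φ v * ((if i = 0 then 0 else c (i-1) y) +
      (if i = 1 then c (k+1) y else 0)), fun i => ?_, fun y x => ?_⟩
    · refine GDeg.add _ _ _ ((GDeg.mul _ _ (φ.comp K.subtype) (hc i)).mono (by omega)) 
        (GDeg.smul (GDeg.add _ _ _ ?_ ?_) _)
      · by_cases hi : i = 0
        · simpa [hi] using GDeg.zero _
        · simpa [hi] using (hc (i-1)).mono (by omega)
      · by_cases hi : i = 1
        · simpa [hi] using (hc (k+1)).mono (by omega)
        · simpa [hi] using GDeg.zero _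
    · simp only []
      rw [hc2, map_add, map_smul, smul_eq_mul, add_mul, hk]
      simp only [mul_add, Finset.sum_add_distrib]
      have hx : x ^ (k+2) = x := by rw [← hk]; exact FiniteField.pow_card x
      congr 1
      · rw [Finset.mul_sum]; refine Finset.sum_congr rfl fun i _ => ?_
        simp; ring
      · rw [Finset.sum_range_succ, Finset.sum_range_succ' (n := k+1)]
        simp
        rw [mul_add, Finset.mul_sum]
        have : x * φ v * (x ^ (k+1) * c (k+1) y) = x * (φ v * c (k+1) y) := by
          calc _ = x^(k+2) * (φ v * c (k+1) y) := by ring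
            _ = _ := by rw [hx]
        rw [this]
        congr 1
        refine Finset.sum_congr rfl fun i _ => ?_
        ring

theorem line_count (d : ℕ) (hd : d < Fintype.card F) (c : ℕ → F) 
    (h0 : c d ≠ 0) :
    Fintype.card F ≤ Set.ncard {x : F | ∑ i ∈ Finset.range (d+1), x ^ i * c i ≠ 0} + d := by
  classical
  let p : Polynomial F := ∑ i ∈ Finset.range (d+1), Polynomial.C (c i) * Polynomial.X ^ i
  have hp : p ≠ 0 := by
    intro hp
    have := congrArg (fun p => Polynomial.coeff p d) hp
    simp [p] at this
    exact h0 this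
  have hdeg : p.natDegree ≤ d := by
    apply Polynomial.natDegree_sum_le_of_forall_le
    intro i hi
    exact (Polynomial.natDegree_C_mul_X_pow_le _ _).trans (by simp at hi; omega)
  have hev : ∀ x, p.eval x = ∑ i ∈ Finset.range (d+1), x ^ i * c i := by
    intro x; simp only [p, Polynomial.eval_finsetSum, Polynomial.eval_mul, Polynomial.eval_C, Polynomial.eval_pow, Polynomial.eval_X]; exact Finset.sum_congr rfl fun i _ => mul_comm _ _
  simp only [← hev]
  have h1 : ({x : F | p.eval x ≠ 0}) = ((Finset.univ \ p.roots.toFinset : Finset F) : Set F) := by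
    ext x; simp [hp]
  rw [h1, Set.ncard_coe_finset, Finset.card_sdiff_of_subset (Finset.subset_univ _), Finset.card_univ]
  have := Multiset.toFinset_card_le p.roots
  have := p.card_roots'
  omega

noncomputable def gw {E : Type} (f : E → F) : ℕ := Set.ncard {x | f x ≠ 0}
noncomputable def gn (f : E → F) (v z : E) : ℕ := Set.ncard {x : F | f (z + x • v) ≠ 0}
def GInv (f : E → F) (v : E) : Prop := ∀ (z : E) (s : F), f (z + s • v) = f z

theorem GDeg.dir {r : ℤ} {f : E → F} (h : GDeg F r f) (hf0 : ∃ z, f z ≠ 0) (φ : E →ₗ[F] F) (v : E)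
    (hv : φ v = 1) : ∃ d : ℕ, d + 1 ≤ Fintype.card F ∧ ∃ c : LinearMap.ker φ → F, (∃ y, c y ≠ 0) ∧
      GDeg F (r - d) c ∧ (∀ y, c y ≠ 0 → Fintype.card F ≤ gn f v y + d) ∧
      (∀ y, c y = 0 → 0 < gn f v y → Fintype.card F + 1 ≤ gn f v y + d) ∧ (d = 0 → GInv f v) := by
  classical
  obtain ⟨c, hc, hc2⟩ := h.decomp (LinearMap.ker φ) v
  have hsplit : ∀ z : E, ∃ y : LinearMap.ker φ, z = y + φ z • v := fun z =>
    ⟨⟨z - φ z • v, by simp [hv]⟩, by simp⟩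
  let P : ℕ → Prop := fun d => d < Fintype.card F ∧ ∃ y, c d y ≠ 0
  have hP : ∃ d, P d := by
    by_contra hcon
    push Not at hcon
    obtain ⟨z, hz⟩ := hf0
    obtain ⟨y, hy⟩ := hsplit z
    rw [hy, hc2] at hz
    apply hz
    refine Finset.sum_eq_zero fun i hi => ?_
    have : c i y = 0 := by
      by_contra h
      exact hcon i ⟨Finset.mem_range.1 hi, y, h⟩
    simp [this]
  obtain ⟨d0, hd0⟩ := hP
  have hb : ∀ d, P d → d ≤ Fintype.card F := fun d h => h.1.le
  let d := Nat.findGreatest P (Fintype.card F)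
  have hd : P d := Nat.findGreatest_spec (hb _ hd0) hd0
  have hmax : ∀ i, i < Fintype.card F → d < i → ∀ y, c i y = 0 := by
    intro i hi hdi y
    by_contra h
    exact absurd (Nat.le_findGreatest (P := P) hi.le (⟨hi, y, h⟩ : P i)) (by omega)
  have hsum : ∀ (y : LinearMap.ker φ) (x : F), ∀ e, d ≤ e → e < Fintype.card F → 
      f (y + x • v) = ∑ i ∈ Finset.range (e+1), x ^ i * c i y := by
    intro y x e hde he
    rw [hc2]
    symm
    apply Finset.sum_subset
    · intro i; simp; omega
    · intro i hi hi2
      simp at hi hi2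
      simp [hmax i hi (by omega) y]
  refine ⟨d, hd.1, c d, hd.2, hc d, ?_, ?_, ?_⟩
  · intro y hy
    have := line_count d hd.1 (fun i => c i y) hy
    unfold gn
    simp only [hsum y _ d le_rfl hd.1]
    exact this
  · intro y hy hpos
    obtain ⟨x, hx⟩ := (Set.ncard_pos (Set.toFinite _)).1 hpos
    have hex : ∃ e, e < d ∧ c e y ≠ 0 := by
      by_contra hcon
      push Not at hcon
      apply hx
      rw [hsum y x d le_rfl hd.1]
      refine Finset.sum_eq_zero fun i hi => ?_
      have : c i y = 0 := by
        rcases Nat.lt_or_ge i d with h | h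
        · exact hcon i h
        · have : i = d := by simp at hi; omega
          rw [this, hy]
      simp [this]
    obtain ⟨e0, he0⟩ := hex
    let Q : ℕ → Prop := fun e => e < d ∧ c e y ≠ 0
    let e := Nat.findGreatest Q d
    have he : Q e := Nat.findGreatest_spec (P := Q) he0.1.le he0
    have hemax : ∀ i, e < i → i < d → c i y = 0 := by
      intro i h1 h2
      by_contra h
      exact absurd (Nat.le_findGreatest (P := Q) h2.le (⟨h2, h⟩ : Q i)) (by omega)
    have h3 := line_count e (he.1.trans hd.1) (fun i => c i y) he.2
    have h4 : ∀ x : F, f (y + x • v) = ∑ i ∈ Finset.range (e+1), x ^ i * c i y := by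
      intro x
      rw [hsum y x d le_rfl hd.1]
      symm
      apply Finset.sum_subset
      · intro i; have := he.1; simp; omega
      · intro i hi hi2
        simp at hi hi2
        have : c i y = 0 := by
          rcases Nat.lt_or_ge i d with h | h
          · exact hemax i (by omega) h
          · have : i = d := by omega
            rw [this, hy]
        simp [this]
    unfold gn
    simp only [h4]
    have := he.1
    omega
  · intro h0 z s
    obtain ⟨y, hy⟩ := hsplit z
    have h1 := hsum y (φ z) d le_rfl hd.1
    have h2 := hsum y (φ z + s) d le_rfl hd.1
    rw [h0] at h1 h2
    simp at h1 h2
    rw [add_smul, ← add_assoc, ← hy] at h2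
    rw [← hy] at h1
    rw [h1, h2]

theorem exists_phi {v : E} (hv : v ≠ 0) : ∃ φ : E →ₗ[F] F, φ v = 1 := by
  obtain ⟨φ, hφ⟩ := Module.Projective.exists_dual_ne_zero F hv
  exact ⟨(φ v)⁻¹ • φ, by simp [hφ]⟩

theorem gcount (φ : E →ₗ[F] F) (v : E) (hv : φ v = 1)
   [Fintype (LinearMap.ker φ)] (f : E → F) : gw f = ∑ y : LinearMap.ker φ, gn f v y := by
  classical
  let e : LinearMap.ker φ × F ≃ E :=
    { toFun := fun p => p.1 + p.2 • v
      invFun := fun z => ⟨⟨z - φ z • v, by simp [hv]⟩, φ z⟩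
      left_inv := by
        rintro ⟨⟨y, hy⟩, x⟩
        have hy' : φ y = 0 := hy
        simp [hv, hy']
      right_inv := by intro z; simp }
  have e1 : {p : LinearMap.ker φ × F // f (p.1 + p.2 • v) ≠ 0} ≃ {z // f z ≠ 0} :=
    e.subtypeEquiv (fun p => Iff.rfl)
  have e2 := (Equiv.subtypeProdEquivSigmaSubtype
    (fun (y : LinearMap.ker φ) (x : F) => f (y + x • v) ≠ 0)).symm.trans e1
  have := Nat.card_congr e2
  rw [Nat.card_sigma] at this
  exact this.symm

variable [Finite E]

theorem gcount_le (φ : E →ₗ[F] F) (v : E) (hv : φ v = 1) (f : E → F) (c : LinearMap.ker φ → F)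
    (k : ℕ) (h : ∀ y, c y ≠ 0 → k ≤ gn f v y) : k * gw c ≤ gw f := by
  classical
  have := Fintype.ofFinite (LinearMap.ker φ)
  rw [gcount φ v hv]
  have h1 : k * gw c = ∑ y : LinearMap.ker φ, if c y ≠ 0 then k else 0 := by
    rw [Finset.sum_ite, gw, Set.ncard_eq_toFinset_card']
    simp [mul_comm]
  rw [h1]
  refine Finset.sum_le_sum fun y _ => ?_
  split_ifs with hy
  · exact h y hy
  · simp

theorem gcount_lt (φ : E →ₗ[F] F) (v : E) (hv : φ v = 1) (f : E → F) (c : LinearMap.ker φ → F)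
    (k : ℕ) (h : ∀ y, c y ≠ 0 → k ≤ gn f v y) (y₀ : LinearMap.ker φ) (h0 : 0 < gn f v y₀)
    (hk : c y₀ ≠ 0 → k < gn f v y₀) : k * gw c < gw f := by
  classical
  have := Fintype.ofFinite (LinearMap.ker φ)
  rw [gcount φ v hv]
  have h1 : k * gw c = ∑ y : LinearMap.ker φ, if c y ≠ 0 then k else 0 := by
    rw [Finset.sum_ite, gw, Set.ncard_eq_toFinset_card']
    simp [mul_comm]
  rw [h1]
  refine Finset.sum_lt_sum (fun y _ => ?_) ⟨y₀, Finset.mem_univ _, ?_⟩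
  · split_ifs with hy
    · exact h y hy
    · simp
  · split_ifs with hy
    · exact hk hy
    · exact h0

theorem gfinrank_ker (φ : E →ₗ[F] F) (v : E) (hv : φ v = 1) :
    finrank F (LinearMap.ker φ) + 1 = finrank F E := by
  have h := LinearMap.finrank_range_add_finrank_ker φ
  have : LinearMap.range φ = ⊤ := by
    rw [LinearMap.range_eq_top]
    intro x
    exact ⟨x • v, by simp [hv]⟩
  rw [this, finrank_top, finrank_self] at h
  omega

theorem gsplit (φ : E →ₗ[F] F) (v : E) (hv : φ v = 1) (z : E) :
    ∃ y : LinearMap.ker φ, z = y + φ z • v :=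
  ⟨⟨z - φ z • v, by simp [hv]⟩, by simp⟩

/-- A line with two points. -/
theorem gn_two (f : E → F) (v z : E) (a b : F) (hab : a ≠ b) (ha : f (z + a • v) ≠ 0)
    (hb : f (z + b • v) ≠ 0) : 1 < gn f v z := by
  rw [gn, Set.one_lt_ncard_iff]
  exact ⟨a, b, ha, hb, hab⟩

theorem gn_pos (f : E → F) (v z : E) (a : F) (ha : f (z + a • v) ≠ 0) : 0 < gn f v z := by
  rw [gn, Set.ncard_pos]
  exact ⟨a, ha⟩

theorem gw_pos {E : Type} [Finite E] {f : E → F} (h : ∃ z, f z ≠ 0) : 0 < gw f := by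
  rw [gw, Set.ncard_pos]
  exact h

/-- Minimum weight. -/
theorem gmin (N : ℕ) : ∀ (E : Type) [AddCommGroup E] [Module F E] [Finite E],
    finrank F E = N → ∀ (A e : ℕ) (f : E → F), 1 ≤ e → e ≤ Fintype.card F →
    GDeg F ((A:ℤ) * (Fintype.card F - 1) + 1 - e) f → (∃ z, f z ≠ 0) →
    e * Fintype.card F ^ N ≤ gw f * Fintype.card F ^ A := by
  have hq : 1 < Fintype.card F := Fintype.one_lt_card
  induction N with
  | zero =>
    intro E _ _ _ hN A e f he1 heq hf hf0
    have h1 := gw_pos hf0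
    rcases Nat.eq_zero_or_pos A with hA | hA
    · subst hA
      have : e ≤ 1 := by
        by_contra hcon
        obtain ⟨z, hz⟩ := hf0
        exact hz (hf.neg_eq (by push_cast; omega) z)
      simp; omega
    · have : Fintype.card F ≤ Fintype.card F ^ A := Nat.le_self_pow (by omega) _
      nlinarith
  | succ N ih =>
    intro E _ _ _ hN A e f he1 heq hf hf0
    have : Nontrivial E := Module.nontrivial_of_finrank_pos (R := F) (by omega)
    obtain ⟨v, hv⟩ := exists_ne (0 : E)
    obtain ⟨φ, hφ⟩ := exists_phi (F := F) hv
    obtain ⟨d, hd, c, hc0, hc, h1, -, -⟩ := hf.dir hf0 φ v hφ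
    have hK := gfinrank_ker φ v hφ
    have hle := gcount_le φ v hφ f c (Fintype.card F - d) (fun y hy => by have := h1 y hy; omega)
    set q := Fintype.card F with hqdef
    obtain ⟨g, hg⟩ : ∃ g, q = d + g := ⟨q - d, by omega⟩
    have hg' : q - d = g := by omega
    rw [hg'] at hle
    rcases Nat.lt_or_ge q (e + d) with hlt | hge
    · rcases Nat.eq_zero_or_pos A with hA | hA
      · subst hA
        obtain ⟨z, hz⟩ := hc0
        exact absurd (hc.neg_eq (by push_cast; omega) z) hz
      · obtain ⟨B, rfl⟩ : ∃ B, A = B + 1 := ⟨A - 1, by omega⟩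
        obtain ⟨e', he'⟩ : ∃ e', e + d + 1 = q + e' := ⟨e + d + 1 - q, by omega⟩
        have h2 := ih (LinearMap.ker φ) (by omega) B e' c (by omega) (by omega)
          (hc.mono (by push_cast; nlinarith)) hc0
        have h3 : e ≤ g * e' := by
          obtain ⟨x, rfl⟩ : ∃ x, g = x + 1 := ⟨g - 1, by omega⟩
          obtain ⟨y, rfl⟩ : ∃ y, e' = y + 1 := ⟨e' - 1, by omega⟩
          have : e = x + y + 1 := by omega
          rw [this]; nlinarith [Nat.zero_le (x*y)]
        calc e * q ^ (N+1) ≤ (g * e') * q ^ (N+1) := Nat.mul_le_mul_right _ h3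
          _ = g * q * (e' * q ^ N) := by ring
          _ ≤ g * q * (gw c * q ^ B) := Nat.mul_le_mul_left _ h2
          _ = (g * gw c) * q ^ (B+1) := by ring
          _ ≤ _ := Nat.mul_le_mul_right _ hle
    · have h2 := ih (LinearMap.ker φ) (by omega) A (e + d) c (by omega) (by omega)
          (hc.mono (by push_cast; omega)) hc0
      have h3 : e * q ≤ g * (e + d) := by
        obtain ⟨x, rfl⟩ : ∃ x, g = e + x := ⟨g - e, by omega⟩
        rw [hg]; nlinarith [Nat.zero_le (d*x)]
      calc e * q ^ (N+1) = (e * q) * q ^ N := by ring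
          _ ≤ (g * (e + d)) * q ^ N := Nat.mul_le_mul_right _ h3
          _ = g * ((e + d) * q ^ N) := by ring
          _ ≤ g * (gw c * q ^ A) := Nat.mul_le_mul_left _ h2
          _ = (g * gw c) * q ^ A := by ring
          _ ≤ _ := Nat.mul_le_mul_right _ hle

/-- Space of invariant directions. -/
def ginv (f : E → F) : Submodule F E where
  carrier := {v | GInv f v}
  zero_mem' := by intro z s; simp
  add_mem' := by
    intro a b ha hb z s
    rw [smul_add, ← add_assoc, hb, ha]
  smul_mem' := by
    intro a v hv z s
    rw [smul_smul, hv]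

end GRM

section GRM2
open Module
set_option linter.unusedSectionVars false
variable {F : Type} [Field F] [Fintype F]
variable {E : Type} [AddCommGroup E] [Module F E] [Finite E]

theorem gflat_ncard (x : E) (V : Submodule F E) :
    Set.ncard {z : E | z - x ∈ V} = Fintype.card F ^ finrank F V := by
  have := Fintype.ofFinite V
  rw [← Module.card_eq_pow_finrank (K := F) (V := V), ← Nat.card_eq_fintype_card, 
    ← Nat.card_coe_set_eq]
  exact Nat.card_congr ((Equiv.subRight x).subtypeEquiv (fun z => by simp))

theorem gflat_le (f : E → F) (x : E) (V : Submodule F E) (h : ∀ z, f z ≠ 0 → z - x ∈ V) :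
    gw f ≤ Fintype.card F ^ finrank F V := by
  rw [← gflat_ncard x V]
  exact Set.ncard_le_ncard h

theorem ginv_mem (f : E → F) {x z : E} (h : z - x ∈ ginv f) : f z = f x := by
  have := h x 1
  simpa using this

theorem gflat_ge (f : E → F) (x : E) (hx : f x ≠ 0) :
    Fintype.card F ^ finrank F (ginv f) ≤ gw f := by
  rw [← gflat_ncard x (ginv f)]
  refine Set.ncard_le_ncard fun z hz => ?_
  simpa [ginv_mem f hz] using hx

theorem gdiff {A e : ℕ} (he : 1 ≤ e) {f : E → F} 
    (hf : GDeg F ((A:ℤ) * (Fintype.card F - 1) + 1 - e) f)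
    {x y : E} (hx : f x ≠ 0) (hy : f y ≠ 0) (hinv : ¬ GInv f (y - x)) :
    ∃ (φ : E →ₗ[F] F) (d : ℕ) (c : LinearMap.ker φ → F), φ (y - x) = 1 ∧ 1 ≤ d ∧
      d + 1 ≤ Fintype.card F ∧ (∃ y, c y ≠ 0) ∧
      GDeg F ((A:ℤ) * (Fintype.card F - 1) + 1 - (e + d : ℕ)) c ∧
      finrank F (LinearMap.ker φ) + 1 = finrank F E ∧
      (Fintype.card F - d) * gw c ≤ gw f ∧ (d + 1 = Fintype.card F → gw c < gw f) ∧
      (gw f ≤ (Fintype.card F - d) * gw c → ∀ z, f z ≠ 0 → ∃ (p : LinearMap.ker φ) (s : F), 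
        z = p + s • (y - x) ∧ c p ≠ 0) ∧ (∀ p, c p ≠ 0 → ∃ s : F, f (p + s • (y-x)) ≠ 0) := by
  have hv : y - x ≠ 0 := by
    intro h
    rw [h] at hinv
    exact hinv (by intro z s; simp)
  obtain ⟨φ, hφ⟩ := exists_phi (F := F) hv
  obtain ⟨d, hd, c, hc0, hc, h1, h2, h3⟩ := hf.dir ⟨x, hx⟩ φ _ hφ
  have h1' : ∀ p, c p ≠ 0 → Fintype.card F - d ≤ gn f (y - x) p := fun p hp => by
    have := h1 p hp; omega
  refine ⟨φ, d, c, hφ, ?_, hd, hc0, ?_, gfinrank_ker φ _ hφ, gcount_le φ _ hφ f c _ h1', ?_, ?_, ?_⟩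
  · by_contra h
    exact hinv (h3 (by omega))
  · convert hc using 1; push_cast; ring
  · intro hdq
    obtain ⟨p, hp⟩ := gsplit φ _ hφ x
    have hy' : y = p + (φ x + 1) • (y - x) := by
      rw [add_smul, ← add_assoc, ← hp]; simp
    have htwo : 1 < gn f (y - x) p := by
      refine gn_two f (y-x) p (φ x) (φ x + 1) (by simp) ?_ ?_
      · rw [← hp]; exact hx
      · rw [← hy']; exact hy
    have := gcount_lt φ _ hφ f c 1 (fun p hp => by have := h1 p hp; omega) p (by omega) (fun _ => htwo)
    omega
  · intro hle z hz
    obtain ⟨p, hp⟩ := gsplit φ _ hφ z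
    refine ⟨p, φ z, hp, fun hcp => ?_⟩
    have := gcount_lt φ _ hφ f c _ h1' p (gn_pos f _ _ (φ z) (by rw [← hp]; exact hz)) (fun h => absurd hcp h)
    omega
  · intro p hp
    have : 0 < gn f (y-x) p := by have := h1 p hp; omega
    rw [gn, Set.ncard_pos] at this
    exact this

theorem glift (φ : E →ₗ[F] F) (v : E) (V : Submodule F (LinearMap.ker φ)) (y₀ : LinearMap.ker φ) :
    ∃ W : Submodule F E, finrank F W ≤ finrank F V + 1 ∧ ∀ (y : LinearMap.ker φ) (s : F),
      y - y₀ ∈ V → (y : E) + s • v - y₀ ∈ W := by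
  refine ⟨V.map (LinearMap.ker φ).subtype ⊔ Submodule.span F {v}, ?_, ?_⟩
  · refine (Submodule.finrank_add_le_finrank_add_finrank _ _).trans ?_
    have h1 := Submodule.finrank_map_le (LinearMap.ker φ).subtype V
    have h2 : finrank F (Submodule.span F {v}) ≤ 1 := by
      simpa using finrank_span_le_card (R := F) ({v} : Set E)
    omega
  · intro y s hy
    have : (y : E) + s • v - y₀ = ((y - y₀ : LinearMap.ker φ) : E) + s • v := by
      push_cast; abel
    rw [this]
    exact Submodule.add_mem_sup (Submodule.mem_map_of_mem hy)
      (Submodule.smul_mem _ _ (Submodule.mem_span_singleton_self v))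

/-- minimum weight words, order A(q-1) -/
theorem gstruct0 {A : ℕ} {f : E → F} (hf : GDeg F ((A:ℤ) * (Fintype.card F - 1)) f)
    (hf0 : ∃ z, f z ≠ 0) (hw : gw f * Fintype.card F ^ A ≤ Fintype.card F ^ (finrank F E)) :
    ∃ (x : E) (V : Submodule F E), finrank F V + A ≤ finrank F E ∧ ∀ z, f z ≠ 0 → z - x ∈ V := by
  obtain ⟨x, hx⟩ := hf0
  have hq : 1 < Fintype.card F := Fintype.one_lt_card
  by_cases hall : ∀ y, f y ≠ 0 → GInv f (y - x)
  · refine ⟨x, ginv f, ?_, hall⟩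
    have := gflat_ge f x hx
    rw [← Nat.pow_le_pow_iff_right hq, pow_add]
    exact (Nat.mul_le_mul_right _ this).trans hw
  · push Not at hall
    obtain ⟨y, hy, hinv⟩ := hall
    obtain ⟨φ, d, c, hφ, hd1, hdq, hc0, hc, hN, hle, hlt, -, -⟩ := gdiff (A := A) (e := 1) le_rfl 
      (hf.mono (by push_cast; omega)) hx hy hinv
    have hm := gmin _ (LinearMap.ker φ) rfl A (1 + d) c (by omega) (by omega) hc hc0
    rw [← hN] at hw
    set q := Fintype.card F
    set N := finrank F (LinearMap.ker φ)
    exfalso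
    have hqN : 0 < q ^ N := by positivity
    have hqA : 0 < q ^ A := by positivity
    by_cases hd : d + 1 = q
    · have h1 := hlt hd
      have h2 : (1 + d) * q ^ N = q ^ (N+1) := by rw [add_comm 1 d, hd]; ring
      rw [h2] at hm
      nlinarith
    · obtain ⟨g, hg⟩ : ∃ g, q = d + (g + 2) := ⟨q - d - 2, by omega⟩
      have hg' : q - d = g + 2 := by omega
      rw [hg'] at hle
      have h1 : (g+2) * (1+d) * q ^ N ≤ q * q ^ N := by
        calc (g+2) * (1+d) * q ^ N = (g+2) * ((1+d) * q ^ N) := by ring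
          _ ≤ (g+2) * (gw c * q ^ A) := Nat.mul_le_mul_left _ hm
          _ = (g+2) * gw c * q ^ A := by ring
          _ ≤ gw f * q ^ A := Nat.mul_le_mul_right _ hle
          _ ≤ q ^ (N+1) := hw
          _ = _ := by ring
      have h2 := Nat.le_of_mul_le_mul_right h1 hqN
      nlinarith

theorem gstruct {A e : ℕ} (he2 : 2 ≤ e) (heq : e + 1 ≤ Fintype.card F) {f : E → F} 
    (hf : GDeg F ((A:ℤ) * (Fintype.card F - 1) + 1 - e) f)
    (hf0 : ∃ z, f z ≠ 0) (hw : gw f * Fintype.card F ^ A ≤ e * Fintype.card F ^ (finrank F E)) :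
    ∃ (x : E) (V : Submodule F E), finrank F V + A ≤ finrank F E + 1 ∧ 
      ∀ z, f z ≠ 0 → z - x ∈ V := by
  obtain ⟨x, hx⟩ := hf0
  have hq : 1 < Fintype.card F := Fintype.one_lt_card
  by_cases hall : ∀ y, f y ≠ 0 → GInv f (y - x)
  · refine ⟨x, ginv f, ?_, hall⟩
    have := gflat_ge f x hx
    rw [← Nat.pow_le_pow_iff_right hq, pow_add, pow_succ']
    exact ((Nat.mul_le_mul_right _ this).trans hw).trans (Nat.mul_le_mul_right _ (by omega))
  · push Not at hall
    obtain ⟨y, hy, hinv⟩ := hall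
    obtain ⟨φ, d, c, hφ, hd1, hdq, hc0, hc, hN, hle, hlt, hall, -⟩ := gdiff (by omega) hf hx hy hinv
    rw [← hN] at hw ⊢
    set q := Fintype.card F with hqdef
    set N := finrank F (LinearMap.ker φ) with hNdef
    have hqN : 0 < q ^ N := by positivity
    have hqA : 0 < q ^ A := by positivity
    obtain ⟨g, hg⟩ : ∃ g, q = d + (g + 1) := ⟨q - d - 1, by omega⟩
    have hg' : q - d = g + 1 := by omega
    rw [hg'] at hle hall
    rcases lt_trichotomy (e + d) q with hlt' | heq' | hgt
    · exfalso
      have hm := gmin _ (LinearMap.ker φ) rfl A (e + d) c (by omega) (by omega) hc hc0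
      have h1 : (g+1) * (e+d) * q ^ N ≤ (e * q) * q ^ N := by
        calc (g+1) * (e+d) * q ^ N = (g+1) * ((e+d) * q ^ N) := by ring
          _ ≤ (g+1) * (gw c * q ^ A) := Nat.mul_le_mul_left _ hm
          _ = (g+1) * gw c * q ^ A := by ring
          _ ≤ gw f * q ^ A := Nat.mul_le_mul_right _ hle
          _ ≤ e * q ^ (N+1) := hw
          _ = _ := by ring
      have h2 := Nat.le_of_mul_le_mul_right h1 hqN
      obtain ⟨k, rfl⟩ : ∃ k, g = e + k := ⟨g - e, by omega⟩
      rw [hg] at h2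
      nlinarith [Nat.zero_le (d * k)]
    · have hm := gmin _ (LinearMap.ker φ) rfl A (e + d) c (by omega) (by omega) hc hc0
      have hA : 1 ≤ A := by
        by_contra h
        obtain ⟨z, hz⟩ := hc0
        have : A = 0 := by omega
        exact hz (hc.neg_eq (by rw [this]; push_cast; omega) z)
      obtain ⟨B, rfl⟩ : ∃ B, A = B + 1 := ⟨A - 1, by omega⟩
      have hge : g + 1 = e := by omega
      have hcw : gw c * q ^ B ≤ q ^ N := by
        have h1 : (e * q) * (gw c * q ^ B) ≤ (e * q) * q ^ N := by
          calc (e * q) * (gw c * q ^ B) = ((g+1) * gw c) * q ^ (B+1) := by rw [hge]; ring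
            _ ≤ gw f * q ^ (B+1) := Nat.mul_le_mul_right _ hle
            _ ≤ e * q ^ (N+1) := hw
            _ = _ := by ring
        exact Nat.le_of_mul_le_mul_left h1 (by positivity)
      obtain ⟨y0, V, hV, hVc⟩ := gstruct0 (A := B) (f := c) (hc.mono (by push_cast; rw [← hqdef]; push_cast [← heq']; nlinarith)) hc0 hcw
      obtain ⟨W, hW, hWs⟩ := glift φ (y - x) V y0
      refine ⟨y0, W, by omega, fun z hz => ?_⟩
      have hwle : gw f ≤ (g+1) * gw c := by
        have h1 : q ^ (B+1) * gw f ≤ q ^ (B+1) * ((g+1) * gw c) := by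
          calc q ^ (B+1) * gw f = gw f * q ^ (B+1) := by ring
            _ ≤ e * q ^ (N+1) := hw
            _ = e * (q * q ^ N) := by ring
            _ ≤ e * (gw c * q ^ (B+1)) := by rw [heq'] at hm; exact Nat.mul_le_mul_left _ hm
            _ = _ := by rw [hge]; ring
        exact Nat.le_of_mul_le_mul_left h1 (by positivity)
      obtain ⟨p, s, hzp, hp⟩ := hall hwle z hz
      rw [hzp]
      exact hWs p s (hVc p hp)
    · exfalso
      have hA : 1 ≤ A := by
        by_contra h
        obtain ⟨z, hz⟩ := hc0
        have : A = 0 := by omega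
        exact hz (hc.neg_eq (by rw [this]; push_cast; omega) z)
      obtain ⟨B, rfl⟩ : ∃ B, A = B + 1 := ⟨A - 1, by omega⟩
      obtain ⟨e', he'⟩ : ∃ e', e + d + 1 = q + e' := ⟨e + d + 1 - q, by omega⟩
      have hm := gmin _ (LinearMap.ker φ) rfl B e' c (by omega) (by omega) 
        (hc.mono (by push_cast; nlinarith)) hc0
      by_cases hd : d + 1 = q
      · have h1 := hlt hd
        have : e' = e := by omega
        subst this
        have : gw f * q ^ (B+1) ≤ gw c * q ^ (B+1) := by
          calc gw f * q ^ (B+1) ≤ e' * q ^ (N+1) := hw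
            _ = q * (e' * q ^ N) := by ring
            _ ≤ q * (gw c * q ^ B) := Nat.mul_le_mul_left _ hm
            _ = _ := by ring
        have := Nat.le_of_mul_le_mul_right this hqA
        omega
      · have h1 : ((g+1) * e') * q ^ (N+1) ≤ e * q ^ (N+1) := by
          calc ((g+1) * e') * q ^ (N+1) = (g+1) * q * (e' * q ^ N) := by ring
            _ ≤ (g+1) * q * (gw c * q ^ B) := Nat.mul_le_mul_left _ hm
            _ = (g+1) * gw c * q ^ (B+1) := by ring
            _ ≤ gw f * q ^ (B+1) := Nat.mul_le_mul_right _ hle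
            _ ≤ _ := hw
        have h2 := Nat.le_of_mul_le_mul_right h1 (by positivity)
        have h3 : e = g + e' := by omega
        obtain ⟨k, rfl⟩ : ∃ k, e' = k + 2 := ⟨e' - 2, by omega⟩
        obtain ⟨l, rfl⟩ : ∃ l, g = l + 1 := ⟨g - 1, by omega⟩
        nlinarith [Nat.zero_le (l * k)]

theorem gM {A : ℕ} {f : E → F} (hq3 : 3 ≤ Fintype.card F) 
    (hf : GDeg F ((A:ℤ) * (Fintype.card F - 1)) f) (x₀ : E)
    (V : Submodule F E) 
    (hin : Fintype.card F ^ finrank F E ≤ Set.ncard {z | f z ≠ 0 ∧ z - x₀ ∈ V} * Fintype.card F ^ A)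
    (hw : gw f * Fintype.card F ^ (A+1) ≤ (2 * (Fintype.card F - 1)) * Fintype.card F ^ finrank F E) :
    ∀ z, f z ≠ 0 → z - x₀ ∈ V := by
  intro z hz
  by_contra hcon
  obtain ⟨l, hl, hVl⟩ := Submodule.exists_le_ker_of_notMem hcon
  have hg := hf.aff l (l x₀)
  set g : E → F := fun x => (l x - l x₀) * f x with hgdef
  set m0 := Set.ncard {z | f z ≠ 0 ∧ z - x₀ ∈ V}
  have h1 := gmin _ E rfl (A+1) (Fintype.card F - 1) g (by omega) (by omega) 
    (hg.mono (by push_cast [Nat.cast_sub (show 1 ≤ Fintype.card F by omega)]; nlinarith)) 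
    ⟨z, by simpa [hgdef, hz, ← map_sub] using hl⟩
  have h2 : gw g + m0 ≤ gw f := by
    rw [gw, gw, ← Set.ncard_union_eq]
    · refine Set.ncard_le_ncard ?_ (Set.toFinite _)
      rintro w (hw | hw)
      · exact fun h => hw (by simp [hgdef, h])
      · exact hw.1
    · rw [Set.disjoint_left]
      intro w hw1 hw2
      apply hw1
      have : l (w - x₀) = 0 := hVl hw2.2
      rw [map_sub] at this
      simp [hgdef, this]
  set q := Fintype.card F
  have h3 : (gw g + m0) * q ^ (A+1) ≤ gw f * q ^ (A+1) := Nat.mul_le_mul_right _ h2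
  have h4 : q * q ^ finrank F E ≤ m0 * q ^ (A+1) := by
    calc _ ≤ q * (m0 * q ^ A) := Nat.mul_le_mul_left _ hin
      _ = _ := by ring
  have h5 : 0 < q ^ finrank F E := by positivity
  obtain ⟨k, hk⟩ : ∃ k, q = k + 1 := ⟨q - 1, by omega⟩
  have hk' : q - 1 = k := by omega
  rw [hk'] at h1 hw
  nlinarith
end GRM2

section GRM3
open Module
set_option linter.unusedSectionVars false
variable {F : Type} [Field F] [Fintype F]
variable {E : Type} [AddCommGroup E] [Module F E] [Finite E]

theorem gprod_deg {E : Type} [AddCommGroup E] [Module F E] {ι : Type} (T : Finset ι)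
    (l : ι → E →ₗ[F] F) : GDeg F (T.card : ℤ) (fun x => ∏ i ∈ T, (l i x - 1)) := by
  classical
  induction T using Finset.induction_on with
  | empty => simpa using GDeg.const 0 le_rfl (1 : F)
  | insert i T hi ih =>
    have := ih.aff (l i) 1
    simp only [Finset.prod_insert hi, Finset.card_insert_of_notMem hi]
    push_cast
    exact this

/-- Jamison's bound in the plane. -/
theorem gjamison (hq3 : 3 ≤ Fintype.card F) (S : Set (F × F)) (h0 : (0, 0) ∈ S)
    (hS : ∀ (z u : F × F), u ≠ 0 → ∃ s : F, z + s • u ∈ S) : 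
    2 * (Fintype.card F - 1) ≤ S.ncard := by
  classical
  by_contra hcon
  set T : Finset (F × F) := S.toFinset.erase (0, 0) with hT
  have hTc : T.card + 1 = S.ncard := by
    rw [hT, Finset.card_erase_add_one (by simpa using h0), Set.ncard_eq_toFinset_card']
  let l : F × F → (F × F) →ₗ[F] F := fun p => p.1 • LinearMap.fst F F F + p.2 • LinearMap.snd F F F
  have hd := gprod_deg T l
  set h : F × F → F := fun x => ∏ i ∈ T, (l i x - 1) with hh
  have hh0 : h 0 ≠ 0 := by
    simp [hh]
  have hz : ∀ x, x ≠ 0 → h x = 0 := by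
    rintro ⟨a, b⟩ hab
    have hne : ((b, -a) : F × F) ≠ 0 := by
      intro hc; apply hab
      simp at hc ⊢; exact ⟨hc.2, hc.1⟩
    obtain ⟨z, hz⟩ : ∃ z : F × F, z.1 * a + z.2 * b = 1 := by
      by_cases ha : a = 0
      · have hb : b ≠ 0 := by rintro rfl; exact hab (by simp [ha])
        exact ⟨(0, b⁻¹), by simp [hb]⟩
      · exact ⟨(a⁻¹, 0), by simp [ha]⟩
    obtain ⟨s, hs⟩ := hS z _ hne
    have hl : l (z + s • (b, -a)) (a, b) = 1 := by
      simp [l]; linear_combination hz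
    apply Finset.prod_eq_zero (i := z + s • (b, -a))
    · rw [hT, Finset.mem_erase]
      refine ⟨?_, by simpa using hs⟩
      intro hc
      rw [hc] at hl
      simp [l] at hl
    · rw [hl]; simp
  have hm := gmin _ (F × F) rfl 2 2 h (by omega) (by omega) (hd.mono (by push_cast; omega)) ⟨0, hh0⟩
  have hw : gw h ≤ 1 := by
    rw [gw, Set.ncard_le_one_iff]
    intro a b ha hb
    have : ∀ c, h c ≠ 0 → c = 0 := fun c hc => by
      by_contra h; exact hc (hz c h)
    rw [this a ha, this b hb]
  have : finrank F (F × F) = 2 := by simp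
  rw [this] at hm
  have h5 : 0 < Fintype.card F ^ 2 := by positivity
  nlinarith

theorem gmeet {f : E → F} (hf : GDeg F ((Fintype.card F : ℤ) - 1) f) (hf0 : ∃ z, f z ≠ 0)
    (hw : gw f * Fintype.card F ^ 2 < 2 * (Fintype.card F - 1) * Fintype.card F ^ finrank F E)
    (u : E) (hu : ¬ GInv f u) (z : E) : ∃ s : F, f (z + s • u) ≠ 0 := by
  have hv : u ≠ 0 := by
    intro h
    rw [h] at hu
    exact hu (by intro z s; simp)
  have hq : 1 < Fintype.card F := Fintype.one_lt_card
  obtain ⟨φ, hφ⟩ := exists_phi (F := F) hv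
  obtain ⟨d, hd, c, hc0, hc, h1, h2, h3⟩ := hf.dir hf0 φ _ hφ
  have hd1 : 1 ≤ d := by
    by_contra h
    exact hu (h3 (by omega))
  have hle := gcount_le φ _ hφ f c (Fintype.card F - d) (fun p hp => by have := h1 p hp; omega)
  have hN := gfinrank_ker φ _ hφ
  have hm := gmin _ (LinearMap.ker φ) rfl 1 (1 + d) c (by omega) (by omega) 
    (hc.mono (by push_cast; omega)) hc0
  have hdq : d + 1 = Fintype.card F := by
    by_contra hne
    rw [← hN] at hw
    set q := Fintype.card F
    set N := finrank F (LinearMap.ker φ)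
    obtain ⟨g, hg⟩ : ∃ g, q = d + (g + 2) := ⟨q - d - 2, by omega⟩
    have hg' : q - d = g + 2 := by omega
    rw [hg'] at hle
    have h1 : (g+2) * (1+d) * q ^ (N+1) < 2 * (q - 1) * q ^ (N+1) := by
      calc (g+2) * (1+d) * q ^ (N+1) = (g+2) * q * ((1+d) * q ^ N) := by ring
          _ ≤ (g+2) * q * (gw c * q ^ 1) := Nat.mul_le_mul_left _ hm
          _ = (g+2) * gw c * q ^ 2 := by ring
          _ ≤ gw f * q ^ 2 := Nat.mul_le_mul_right _ hle
          _ < _ := hw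
    have h2 := Nat.lt_of_mul_lt_mul_right h1
    have h4 : q - 1 = d + g + 1 := by omega
    rw [h4] at h2
    obtain ⟨k, rfl⟩ : ∃ k, d = k + 1 := ⟨d - 1, by omega⟩
    nlinarith [Nat.zero_le (k*g)]
  obtain ⟨p, hp⟩ := gsplit φ _ hφ z
  obtain ⟨y, hy⟩ := hc0
  have hcp : c p ≠ 0 := by
    rw [hc.const_eq (by push_cast; omega) p y]; exact hy
  have : 0 < gn f u p := by have := h1 p hcp; omega
  rw [gn, Set.ncard_pos] at this
  obtain ⟨s, hs⟩ := this
  refine ⟨s - φ z, ?_⟩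
  have : z + (s - φ z) • u = p + s • u := by
    rw [sub_smul]; nth_rewrite 1 [hp]; abel
  rw [this]
  exact hs

/-- averaging over translates of a plane -/
theorem gaverage (f : E → F) (u w : E) (M : ℕ) 
    (h : gw f * Fintype.card F ^ 2 < M * Fintype.card F ^ finrank F E) :
    ∃ z, Set.ncard {p : F × F | f (z + p.1 • u + p.2 • w) ≠ 0} < M := by
  classical
  by_contra hcon
  push Not at hcon
  have := Fintype.ofFinite E
  have h1 : ∑ z : E, Set.ncard {p : F × F | f (z + p.1 • u + p.2 • w) ≠ 0} = 
      gw f * Fintype.card F ^ 2 := by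
    simp only [Set.ncard_eq_toFinset_card', Set.toFinset_setOf, Finset.card_filter]
    rw [Finset.sum_comm]
    have : ∀ p : F × F, (∑ z : E, if f (z + p.1 • u + p.2 • w) ≠ 0 then 1 else 0) = gw f := by
      intro p
      rw [gw, Set.ncard_eq_toFinset_card', Set.toFinset_setOf, Finset.card_filter]
      refine Fintype.sum_equiv (Equiv.addRight (p.1 • u + p.2 • w)) _ _ fun z => ?_
      simp [add_assoc]
    simp only [this]
    simp [Fintype.card_prod]; ring
  have h2 : ∑ z : E, M ≤ ∑ z : E, Set.ncard {p : F × F | f (z + p.1 • u + p.2 • w) ≠ 0} :=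
    Finset.sum_le_sum fun z _ => hcon z
  rw [h1] at h2
  simp only [Finset.sum_const, Finset.card_univ, smul_eq_mul] at h2
  rw [Module.card_eq_pow_finrank (K := F)] at h2
  nlinarith

theorem gflat_two (f : E → F) (x y : E) (hx : f x ≠ 0) (hy : f y ≠ 0) (h : ¬ GInv f (y - x)) :
    2 * Fintype.card F ^ finrank F (ginv f) ≤ gw f := by
  rw [two_mul]
  nth_rewrite 1 [← gflat_ncard x (ginv f)]
  rw [← gflat_ncard y (ginv f), gw, ← Set.ncard_union_eq]
  · refine Set.ncard_le_ncard ?_ (Set.toFinite _)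
    rintro z (hz | hz)
    · simpa [ginv_mem f hz] using hx
    · simpa [ginv_mem f hz] using hy
  · rw [Set.disjoint_left]
    intro z h1 h2
    have : (z - x) - (z - y) ∈ ginv f := Submodule.sub_mem _ h1 h2
    simp at this
    exact h this

theorem gall {A : ℕ} (f : E → F) (x : E) (hx : f x ≠ 0)
    (hw : gw f * Fintype.card F ^ (A+1) ≤ 2 * (Fintype.card F - 1) * Fintype.card F ^ finrank F E) :
    finrank F (ginv f) + A ≤ finrank F E := by
  have hq : 1 < Fintype.card F := Fintype.one_lt_card
  have h1 := gflat_ge f x hx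
  set q := Fintype.card F
  have h2 : q ^ (finrank F (ginv f) + (A + 1)) < q ^ (finrank F E + 2) := by
    calc q ^ (finrank F (ginv f) + (A + 1)) = q ^ (finrank F (ginv f)) * q ^ (A+1) := by ring
      _ ≤ gw f * q ^ (A+1) := Nat.mul_le_mul_right _ h1
      _ ≤ _ := hw
      _ < q ^ 2 * q ^ finrank F E := by
        apply Nat.mul_lt_mul_of_pos_right _ (by positivity)
        obtain ⟨k, hk⟩ : ∃ k, q = k + 1 := ⟨q - 1, by omega⟩
        rw [hk]; simp; nlinarith
      _ = _ := by ring
  rw [Nat.pow_lt_pow_iff_right hq] at h2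
  omega

theorem ggap1 (hq3 : 3 ≤ Fintype.card F) {f : E → F} 
    (hf : GDeg F ((Fintype.card F : ℤ) - 1) f) (hf0 : ∃ z, f z ≠ 0)
    (hw : gw f * Fintype.card F ^ 2 < 2 * (Fintype.card F - 1) * Fintype.card F ^ finrank F E) :
    gw f * Fintype.card F ≤ Fintype.card F ^ finrank F E := by
  obtain ⟨x, hx⟩ := hf0
  have hq : 1 < Fintype.card F := Fintype.one_lt_card
  have hdim := gall (A := 1) f x hx hw.le
  by_cases hall : ∀ y, f y ≠ 0 → GInv f (y - x)
  · have := gflat_le f x (ginv f) hall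
    calc _ ≤ Fintype.card F ^ finrank F (ginv f) * Fintype.card F := Nat.mul_le_mul_right _ this
      _ = Fintype.card F ^ (finrank F (ginv f) + 1) := by ring
      _ ≤ _ := Nat.pow_le_pow_right (by omega) hdim
  exfalso
  push Not at hall
  obtain ⟨y, hy, hu⟩ := hall
  set u := y - x
  have h2 := gflat_two f x y hx hy hu
  have hne : ∃ w, w ∉ ginv f ⊔ Submodule.span F {u} := by
    by_contra hcon
    push Not at hcon
    have htop : ginv f ⊔ Submodule.span F {u} = ⊤ := by
      rw [eq_top_iff]; intro w _; exact hcon w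
    have h3 := Submodule.finrank_add_le_finrank_add_finrank (ginv f) (Submodule.span F {u})
    rw [htop, finrank_top] at h3
    have h4 : finrank F (Submodule.span F {u}) ≤ 1 := by
      simpa using finrank_span_le_card (R := F) ({u} : Set E)
    have h5 : finrank F E = finrank F (ginv f) + 1 := by omega
    rw [h5] at hw
    set q := Fintype.card F
    have h6 : 0 < q ^ finrank F (ginv f) := by positivity
    have h7 : 2 * q ^ finrank F (ginv f) * q ^ 2 < 2 * (q - 1) * q ^ (finrank F (ginv f) + 1) :=
      (Nat.mul_le_mul_right _ h2).trans_lt hw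
    have h8 : 2 * (q - 1) * q ^ (finrank F (ginv f) + 1) ≤ 2 * q * q ^ (finrank F (ginv f) + 1) :=
      Nat.mul_le_mul_right _ (by omega)
    have h9 : 2 * q * q ^ (finrank F (ginv f) + 1) = 2 * q ^ finrank F (ginv f) * q ^ 2 := by ring
    omega
  obtain ⟨w, hw'⟩ := hne
  have hdir : ∀ p : F × F, p ≠ 0 → ¬ GInv f (p.1 • u + p.2 • w) := by
    rintro ⟨a, b⟩ hp hinv
    have hinv' : a • u + b • w ∈ ginv f := hinv
    by_cases hb : b = 0
    · subst hb
      have ha : a ≠ 0 := by rintro rfl; exact hp rfl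
      simp at hinv'
      apply hu
      have := (ginv f).smul_mem a⁻¹ hinv'
      rw [smul_smul, inv_mul_cancel₀ ha, one_smul] at this
      exact this
    · apply hw'
      have h1 : w = b⁻¹ • (a • u + b • w) + (-(b⁻¹ * a)) • u := by
        rw [smul_add, smul_smul, smul_smul, inv_mul_cancel₀ hb, one_smul, neg_smul]; abel
      rw [h1]
      exact Submodule.add_mem_sup ((ginv f).smul_mem _ hinv') 
        (Submodule.smul_mem _ _ (Submodule.mem_span_singleton_self u))
  obtain ⟨z, hz⟩ := gaverage f u w _ hw
  have hmeet : ∀ (z : E) (p : F × F), p ≠ 0 → ∃ s : F, f (z + s • (p.1 • u + p.2 • w)) ≠ 0 :=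
    fun z p hp => gmeet hf ⟨x, hx⟩ hw _ (hdir p hp) z
  obtain ⟨s0, hs0⟩ := hmeet z (1, 0) (by simp)
  set S : Set (F × F) := {p | f (z + s0 • u + p.1 • u + p.2 • w) ≠ 0} with hSdef
  have hS := gjamison hq3 S (by simpa [hSdef] using hs0) (by
    intro p d hd
    obtain ⟨s, hs⟩ := hmeet (z + s0 • u + p.1 • u + p.2 • w) d hd
    refine ⟨s, ?_⟩
    rw [hSdef]
    convert hs using 2
    simp [add_smul, mul_smul]; abel_nf)
  have hSc : S.ncard = Set.ncard {p : F × F | f (z + p.1 • u + p.2 • w) ≠ 0} := by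
    rw [← Nat.card_coe_set_eq, ← Nat.card_coe_set_eq]
    refine Nat.card_congr ((Equiv.addRight ((s0, 0) : F × F)).subtypeEquiv fun p => ?_)
    simp only [hSdef, Set.mem_setOf_eq, Equiv.coe_addRight, Prod.fst_add, Prod.snd_add, add_zero, add_smul]
    rw [show z + s0 • u + p.1 • u = z + (p.1 • u + s0 • u) by abel]
  omega

/-- common argument -/
theorem gcase {A : ℕ} (hq3 : 3 ≤ Fintype.card F) {f : E → F} 
    (hf : GDeg F (((A+1:ℕ):ℤ) * (Fintype.card F - 1)) f)
    (φ : E →ₗ[F] F) (v : E) (hφ : φ v = 1) (c : LinearMap.ker φ → F) 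
    (hc : GDeg F ((A:ℤ) * (Fintype.card F - 1)) c) (hc0 : ∃ y, c y ≠ 0)
    (hcf : ∀ p, c p ≠ 0 → ∃ s : F, f (p + s • v) ≠ 0)
    (hcw : gw c * Fintype.card F ^ A ≤ Fintype.card F ^ finrank F (LinearMap.ker φ))
    (hw : gw f * Fintype.card F ^ (A+2) ≤ 2 * (Fintype.card F - 1) * Fintype.card F ^ finrank F E) :
    ∃ (x : E) (V : Submodule F E), finrank F V + A ≤ finrank F E ∧ ∀ z, f z ≠ 0 → z - x ∈ V := by
  classical
  obtain ⟨y0, V', hV', hVc⟩ := gstruct0 hc hc0 hcw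
  obtain ⟨V, hV, hVs⟩ := glift φ v V' y0
  have hN := gfinrank_ker φ v hφ
  refine ⟨y0, V, by omega, gM hq3 hf y0 V ?_ hw⟩
  have hm := gmin _ (LinearMap.ker φ) rfl A 1 c le_rfl (by omega) (hc.mono (by push_cast; omega)) hc0
  let f' : E → F := fun z => if z - y0 ∈ V then f z else 0
  have h1 : 1 * gw c ≤ gw f' := gcount_le φ v hφ f' c 1 (fun y hy => by
    obtain ⟨s, hs⟩ := hcf y hy
    refine gn_pos f' v y s ?_
    have := hVs y s (hVc y hy)
    simpa [f', this] using hs)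
  have h2 : gw f' = Set.ncard {z | f z ≠ 0 ∧ z - (y0 : E) ∈ V} := by
    rw [gw]; congr 1; ext z; simp [f', and_comm]
  rw [← h2, ← hN]
  set q := Fintype.card F
  calc _ = q * (1 * q ^ finrank F (LinearMap.ker φ)) := by ring
    _ ≤ q * (gw c * q ^ A) := Nat.mul_le_mul_left _ hm
    _ = (1 * gw c) * q ^ (A+1) := by ring
    _ ≤ _ := Nat.mul_le_mul_right _ h1

theorem ggap (hq3 : 3 ≤ Fintype.card F) (A : ℕ) : 
    ∀ (E : Type) [AddCommGroup E] [Module F E] [Finite E] (f : E → F),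
    GDeg F ((A:ℤ) * (Fintype.card F - 1)) f → (∃ z, f z ≠ 0) →
    gw f * Fintype.card F ^ (A + 1) < 2 * (Fintype.card F - 1) * Fintype.card F ^ finrank F E →
    gw f * Fintype.card F ^ A ≤ Fintype.card F ^ finrank F E := by
  induction A with
  | zero =>
    intro E _ _ _ f hf hf0 hw
    have := gflat_le f 0 ⊤ (by simp)
    simpa using this
  | succ A ih =>
    intro E _ _ _ f hf hf0 hw
    rcases Nat.eq_zero_or_pos A with rfl | hA
    · simpa using ggap1 hq3 (by simpa using hf) hf0 hw
    obtain ⟨x, hx⟩ := hf0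
    have hdim := gall (A := A + 1) f x hx hw.le
    by_cases hall : ∀ y, f y ≠ 0 → GInv f (y - x)
    · have := gflat_le f x (ginv f) hall
      calc _ ≤ Fintype.card F ^ finrank F (ginv f) * Fintype.card F ^ (A+1) := Nat.mul_le_mul_right _ this
        _ = Fintype.card F ^ (finrank F (ginv f) + (A + 1)) := by ring
        _ ≤ _ := Nat.pow_le_pow_right (by omega) hdim
    push Not at hall
    obtain ⟨y, hy, hinv⟩ := hall
    obtain ⟨φ, d, c, hφ, hd1, hdq, hc0, hc, hN, hle, hlt, -, hcf⟩ := gdiff (A := A+1) (e := 1) le_rfl 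
      (hf.mono (by push_cast; omega)) hx hy hinv
    have hm := gmin _ (LinearMap.ker φ) rfl (A+1) (1 + d) c (by omega) (by omega) hc hc0
    have hdq : d + 1 = Fintype.card F := by
      by_contra hne
      rw [← hN] at hw
      set q := Fintype.card F
      set N := finrank F (LinearMap.ker φ)
      obtain ⟨g, hg⟩ : ∃ g, q = d + (g + 2) := ⟨q - d - 2, by omega⟩
      have hg' : q - d = g + 2 := by omega
      rw [hg'] at hle
      have h1 : (g+2) * (1+d) * q ^ (N+1) < 2 * (q - 1) * q ^ (N+1) := by
        calc (g+2) * (1+d) * q ^ (N+1) = (g+2) * q * ((1+d) * q ^ N) := by ring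
            _ ≤ (g+2) * q * (gw c * q ^ (A+1)) := Nat.mul_le_mul_left _ hm
            _ = (g+2) * gw c * q ^ (A+1+1) := by ring
            _ ≤ gw f * q ^ (A+1+1) := Nat.mul_le_mul_right _ hle
            _ < _ := hw
      have h2 := Nat.lt_of_mul_lt_mul_right h1
      have h4 : q - 1 = d + g + 1 := by omega
      rw [h4] at h2
      obtain ⟨k, rfl⟩ : ∃ k, d = k + 1 := ⟨d - 1, by omega⟩
      nlinarith [Nat.zero_le (k*g)]
    -- the IH in the form used twice
    have key : ∀ (ψ : E →ₗ[F] F) (v : E) (c : LinearMap.ker ψ → F), ψ v = 1 → (∃ y, c y ≠ 0) →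
        GDeg F ((A:ℤ) * (Fintype.card F - 1)) c → gw c ≤ gw f → 
        gw c * Fintype.card F ^ A ≤ Fintype.card F ^ finrank F (LinearMap.ker ψ) := by
      intro ψ v c hψ hc0 hc hcw
      apply ih _ c hc hc0
      have hN := gfinrank_ker ψ v hψ
      rw [← hN] at hw
      set q := Fintype.card F
      have h1 : q * (gw c * q ^ (A+1)) < q * (2 * (q - 1) * q ^ finrank F (LinearMap.ker ψ)) := by
        calc q * (gw c * q ^ (A+1)) = gw c * q ^ (A+1+1) := by ring
          _ ≤ gw f * q ^ (A+1+1) := Nat.mul_le_mul_right _ hcw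
          _ < _ := hw
          _ = _ := by ring
      exact Nat.lt_of_mul_lt_mul_left h1
    have hc' : GDeg F ((A:ℤ) * (Fintype.card F - 1)) c := 
      hc.mono (by rw [← hdq]; push_cast; nlinarith)
    obtain ⟨x0, V, hV, hVs⟩ := gcase hq3 hf φ _ hφ c hc' hc0 hcf (key φ _ c hφ hc0 hc' (hlt hdq).le) hw.le
    have hVt : V < ⊤ := by
      rw [lt_top_iff_ne_top]
      rintro rfl
      rw [finrank_top] at hV
      omega
    obtain ⟨l, hl0, hVl⟩ := Submodule.exists_le_ker_of_lt_top V hVt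
    obtain ⟨w0, hw0⟩ : ∃ w, l w ≠ 0 := by
      by_contra h
      push Not at h
      exact hl0 (LinearMap.ext h)
    have hlw : l ((l w0)⁻¹ • w0) = 1 := by simp [hw0]
    set w := (l w0)⁻¹ • w0
    have hlS : ∀ z, f z ≠ 0 → l z = l x0 := by
      intro z hz
      have : l (z - x0) = 0 := hVl (hVs z hz)
      rwa [map_sub, sub_eq_zero] at this
    obtain ⟨d', hd', c', hc0', hcd', h1', h2', -⟩ := hf.dir ⟨x, hx⟩ l w hlw
    have hn1 : ∀ p : LinearMap.ker l, gn f w p ≤ 1 := by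
      intro p
      rw [gn, Set.ncard_le_one_iff]
      intro a b ha hb
      have h1 := hlS _ ha
      have h2 := hlS _ hb
      have hp : l (p : E) = 0 := p.2
      simp [hlw, hp] at h1 h2
      rw [h1, h2]
    have hdq' : d' + 1 = Fintype.card F := by
      obtain ⟨p, hp⟩ := hc0'
      have := h1' p hp
      have := hn1 p
      omega
    have hsup : ∀ p : LinearMap.ker l, 0 < gn f w p → c' p ≠ 0 := by
      intro p hp hcp
      have := h2' p hcp hp
      have := hn1 p
      omega
    have hle' := gcount_le l w hlw f c' 1 (fun p hp => by have := h1' p hp; omega)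
    have hge' : gw f ≤ gw c' := by
      rw [gw, gw]
      have himg : {z | f z ≠ 0} ⊆ (fun p : LinearMap.ker l => (p : E) + l x0 • w) '' {p | c' p ≠ 0} := by
        intro z hz
        obtain ⟨p, hp⟩ := gsplit l w hlw z
        refine ⟨p, hsup p (gn_pos f w p (l z) (by rw [← hp]; exact hz)), ?_⟩
        rw [hlS z hz] at hp
        exact hp.symm
      exact (Set.ncard_le_ncard himg (Set.toFinite _)).trans (Set.ncard_image_le (Set.toFinite _))
    have h5 := key l w c' hlw hc0' (hcd'.mono (by rw [← hdq']; push_cast; nlinarith)) (by omega)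
    have hN' := gfinrank_ker l w hlw
    rw [← hN']
    set q := Fintype.card F
    calc gw f * q ^ (A+1) ≤ gw c' * q ^ (A+1) := Nat.mul_le_mul_right _ hge'
      _ = q * (gw c' * q ^ A) := by ring
      _ ≤ q * q ^ finrank F (LinearMap.ker l) := Nat.mul_le_mul_left _ h5
      _ = _ := by ring

theorem gmain (hq3 : 3 ≤ Fintype.card F) {A : ℕ} {f : E → F} 
    (hf : GDeg F (((A+1:ℕ):ℤ) * (Fintype.card F - 1)) f) (hf0 : ∃ z, f z ≠ 0)
    (hw : gw f * Fintype.card F ^ (A+2) = 2 * (Fintype.card F - 1) * Fintype.card F ^ finrank F E) :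
    ∃ (x : E) (V : Submodule F E), finrank F V + A ≤ finrank F E ∧ ∀ z, f z ≠ 0 → z - x ∈ V := by
  obtain ⟨x, hx⟩ := hf0
  have hdim := gall (A := A + 1) f x hx hw.le
  by_cases hall : ∀ y, f y ≠ 0 → GInv f (y - x)
  · exact ⟨x, ginv f, by omega, hall⟩
  push Not at hall
  obtain ⟨y, hy, hinv⟩ := hall
  obtain ⟨φ, d, c, hφ, hd1, hdq, hc0, hc, hN, hle, hlt, hcov, hcf⟩ := gdiff (A := A+1) (e := 1) le_rfl 
    (hf.mono (by push_cast; omega)) hx hy hinv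
  have hm := gmin _ (LinearMap.ker φ) rfl (A+1) (1 + d) c (by omega) (by omega) hc hc0
  by_cases hdq' : d + 1 = Fintype.card F
  · have hc' : GDeg F ((A:ℤ) * (Fintype.card F - 1)) c := 
      hc.mono (by rw [← hdq']; push_cast; nlinarith)
    refine gcase hq3 hf φ _ hφ c hc' hc0 hcf (ggap hq3 A _ c hc' hc0 ?_) hw.le
    rw [← hN] at hw
    have hcw := hlt hdq'
    set q := Fintype.card F
    have h1 : q * (gw c * q ^ (A+1)) < q * (2 * (q - 1) * q ^ finrank F (LinearMap.ker φ)) := by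
      calc q * (gw c * q ^ (A+1)) = gw c * q ^ (A+2) := by ring
        _ < gw f * q ^ (A+2) := Nat.mul_lt_mul_of_pos_right hcw (by positivity)
        _ = _ := hw
        _ = _ := by ring
    exact Nat.lt_of_mul_lt_mul_left h1
  · rw [← hN] at hw ⊢
    set q := Fintype.card F
    set N := finrank F (LinearMap.ker φ) with hNdef
    obtain ⟨g, hg⟩ : ∃ g, q = d + (g + 2) := ⟨q - d - 2, by omega⟩
    have hg' : q - d = g + 2 := by omega
    rw [hg'] at hle hcov
    have h1 : (g+2) * (1+d) * q ^ (N+1) ≤ 2 * (q - 1) * q ^ (N+1) := by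
      calc (g+2) * (1+d) * q ^ (N+1) = (g+2) * q * ((1+d) * q ^ N) := by ring
          _ ≤ (g+2) * q * (gw c * q ^ (A+1)) := Nat.mul_le_mul_left _ hm
          _ = (g+2) * gw c * q ^ (A+2) := by ring
          _ ≤ gw f * q ^ (A+2) := Nat.mul_le_mul_right _ hle
          _ = _ := hw
    have h2 := Nat.le_of_mul_le_mul_right h1 (by positivity)
    have h4 : q - 1 = d + g + 1 := by omega
    have h5 : 2 * (q - 1) = (g + 2) * (1 + d) := by
      apply le_antisymm _ h2
      rw [h4]
      obtain ⟨k, rfl⟩ : ∃ k, d = k + 1 := ⟨d - 1, by omega⟩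
      nlinarith [Nat.zero_le (k*g)]
    rw [h5] at hw
    have h6 : gw c * q ^ (A+1) ≤ (1+d) * q ^ N := by
      have : ((g+2) * q) * (gw c * q ^ (A+1)) ≤ ((g+2) * q) * ((1+d) * q ^ N) := by
        calc ((g+2) * q) * (gw c * q ^ (A+1)) = (g+2) * gw c * q ^ (A+2) := by ring
          _ ≤ gw f * q ^ (A+2) := Nat.mul_le_mul_right _ hle
          _ = _ := hw
          _ = _ := by ring
      exact Nat.le_of_mul_le_mul_left this (by positivity)
    have h7 : gw f ≤ (g+2) * gw c := by
      have : gw f * q ^ (A+2) ≤ ((g+2) * gw c) * q ^ (A+2) := by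
        calc gw f * q ^ (A+2) = (g+2) * q * ((1+d) * q ^ N) := by rw [hw]; ring
          _ ≤ (g+2) * q * (gw c * q ^ (A+1)) := Nat.mul_le_mul_left _ hm
          _ = _ := by ring
      exact Nat.le_of_mul_le_mul_right this (by positivity)
    obtain ⟨y0, V', hV', hVc⟩ := gstruct (by omega) (by omega) hc hc0 h6
    obtain ⟨V, hV, hVs⟩ := glift φ (y - x) V' y0
    refine ⟨y0, V, by omega, fun z hz => ?_⟩
    obtain ⟨p, s, hzp, hp⟩ := hcov h7 z hz
    rw [hzp]
    exact hVs p s (hVc p hp)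
end GRM3

section GRM4
open Module
set_option linter.unusedSectionVars false
variable {F : Type} [Field F] [Fintype F]

theorem gext {E : Type} [AddCommGroup E] [Module F E] [Finite E] (V : Submodule F E) (k : ℕ)
    (h1 : finrank F V ≤ k) (h2 : k ≤ finrank F E) :
    ∃ W : Submodule F E, V ≤ W ∧ finrank F W = k := by
  induction k, h1 using Nat.le_induction with
  | base => exact ⟨V, le_rfl, rfl⟩
  | succ k hk ih =>
    obtain ⟨W, hVW, hW⟩ := ih (by omega)
    have hne : W ≠ ⊤ := by
      rintro rfl
      rw [finrank_top] at hW
      omega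
    obtain ⟨v, hv⟩ : ∃ v, v ∉ W := by
      by_contra! h
      exact hne (Submodule.eq_top_iff'.2 h)
    refine ⟨W ⊔ Submodule.span F {v}, hVW.trans le_sup_left, ?_⟩
    have h3 := Submodule.finrank_sup_add_finrank_inf_eq W (Submodule.span F {v})
    have hv0 : v ≠ 0 := fun h => hv (h ▸ W.zero_mem)
    have h4 : W ⊓ Submodule.span F {v} = ⊥ := by
      rw [← disjoint_iff, Submodule.disjoint_span_singleton' hv0]
      exact hv
    rw [h4, finrank_bot, finrank_span_singleton hv0] at h3
    omega

theorem gmonom {m : ℕ} (s : Finset (Fin m)) (e : Fin m → ℕ) :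
    GDeg F ((∑ i ∈ s, e i : ℕ) : ℤ) (fun x : Fin m → F => ∏ i ∈ s, x i ^ e i) := by
  classical
  induction s using Finset.induction_on with
  | empty => simpa using GDeg.const 0 le_rfl (1 : F)
  | insert i s hi ih =>
    simp only [Finset.prod_insert hi, Finset.sum_insert hi]
    generalize e i = n
    induction n with
    | zero => simpa using ih
    | succ n ihn =>
      have := GDeg.mul _ _ (LinearMap.proj i : (Fin m → F) →ₗ[F] F) ihn
      have h1 : ((n + ∑ i ∈ s, e i : ℕ) : ℤ) + 1 = ((n + 1 + ∑ i ∈ s, e i : ℕ) : ℤ) := by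
        push_cast
        ring
      rw [h1] at this
      have h2 : (fun x : Fin m → F => x i ^ (n + 1) * ∏ i ∈ s, x i ^ e i) =
          fun x => (LinearMap.proj i : (Fin m → F) →ₗ[F] F) x *
            (x i ^ n * ∏ i ∈ s, x i ^ e i) := by
        funext x
        rw [LinearMap.proj_apply, pow_succ]
        ring
      rw [h2]
      exact this

theorem gRM {m r : ℕ} {f : (Fin m → F) → F} (h : RM F r m f) : GDeg F (r : ℤ) f := by
  classical
  obtain ⟨P, hP, hPf⟩ := h
  have hfe : f = fun x => ∑ d ∈ P.support, P.coeff d * ∏ i ∈ d.support, x i ^ d i := by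
    funext x
    rw [← hPf, MvPolynomial.eval_eq]
  rw [hfe]
  have key : ∀ T : Finset (Fin m →₀ ℕ), T ⊆ P.support →
      GDeg F (r : ℤ) (fun x : Fin m → F =>
        ∑ d ∈ T, P.coeff d * ∏ i ∈ d.support, x i ^ d i) := by
    intro T
    induction T using Finset.induction_on with
    | empty => intro _; simpa using GDeg.zero (r : ℤ)
    | insert d T hd ih =>
      intro hT
      simp only [Finset.sum_insert hd]
      refine GDeg.add _ _ _ ?_ (ih (fun x hx => hT (Finset.mem_insert_of_mem hx)))
      refine GDeg.smul ((gmonom d.support d).mono ?_) _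
      have := MvPolynomial.le_totalDegree (hT (Finset.mem_insert_self d T))
      have h2 : ∑ i ∈ d.support, d i ≤ r := le_trans this hP
      exact_mod_cast h2
  exact key _ subset_rfl

end GRM4

/-- A second weight codeword of `R_q(t(q-1), m)` (weight `2(q-1)q^(m-t-1)`) has its
support contained in an affine subspace of dimension `m-t+1`. -/
theorem stmt15 {F : Type} [Field F] [Fintype F] [DecidableEq F] {m t : ℕ}
    (hq : 3 ≤ Fintype.card F) (hm : 2 ≤ m) (ht1 : 1 ≤ t) (ht2 : t ≤ m - 1)
    (f : (Fin m → F) → F)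
    (hf : RM F (t * (Fintype.card F - 1)) m f)
    (hw : wt f = 2 * (Fintype.card F - 1) * Fintype.card F ^ (m - t - 1)) :
    ∃ W : AffineSubspace F (Fin m → F),
      (W : Set (Fin m → F)).Nonempty ∧ Module.finrank F W.direction = m - t + 1 ∧
      ∀ x : Fin m → F, f x ≠ 0 → x ∈ W := by
  obtain ⟨A, rfl⟩ : ∃ A, t = A + 1 := ⟨t - 1, by omega⟩
  have hg := gRM hf
  have hwg : gw f = wt f := by
    unfold gw wt
    rw [← Set.ncard_coe_finset]
    simp
  have hpos : 0 < wt f := by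
    rw [hw]
    have : 0 < Fintype.card F - 1 := by omega
    have h2 : 0 < Fintype.card F := by omega
    positivity
  have hfr : Module.finrank F (Fin m → F) = m := by simp
  have hf0 : ∃ z, f z ≠ 0 := by
    obtain ⟨z, hz⟩ := Finset.card_pos.1 hpos
    exact ⟨z, (Finset.mem_filter.1 hz).2⟩
  obtain ⟨x, V, hV, hVf⟩ := gmain hq (A := A) (f := f)
    (by
      convert hg using 1
      rw [Nat.cast_mul, Nat.cast_sub (by omega)]
      simp) hf0 (by
      rw [hwg, hw, hfr, mul_assoc, ← pow_add]
      congr 2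
      omega)
  rw [hfr] at hV
  obtain ⟨W, hVW, hW⟩ := gext V (m - (A + 1) + 1) (by omega) (by rw [hfr]; omega)
  refine ⟨AffineSubspace.mk' x W, ⟨x, AffineSubspace.self_mem_mk' x W⟩, ?_, ?_⟩
  · rw [AffineSubspace.direction_mk', hW]
  · intro z hz
    rw [AffineSubspace.mem_mk']
    exact hVW (hVf z hz)
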